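/- Let a < b be real numbers, Q ∈ ℝ, and f : [a,b] → ℝ a smooth positive function such that: (i) f''(s) < (1/(2 f(s)))(1 − f'(s)² − Q²/f(s)²) for all s ∈ [a,b]; (ii) f(b) > |Q|; (iii) f'(b) > 0; and (iv) m* := (f(b)/2)·(1 + Q²/f(b)² − f'(b)²) > |Q|. Then for every m_e > m* there exist L ≥ b and a smooth positive function F : [a,∞) → ℝ such that: (I) F = f on [a, (a+b)/2]; (II) F''(s) ≤ (1/(2 F(s)))(1 − F'(s)² − Q²/F(s)²) for all s ≥ a; (III) for all s ≥ L, F'(s) > 0 and F'(s)² = 1 − 2 m_e/F(s) + Q²/F(s)², and F(s) → ∞ as s → ∞; and (IV) if in addition f' > 0 on (a,b], then F' > 0 on (a,∞). -/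

import Mathlib

open scoped ContDiff

theorem aux_diffeo (k : ℝ → ℝ) (hk : ContDiff ℝ ∞ k) (e : ℝ) (he : 0 < e) (hke : ∀ x, e ≤ k x)
    (x0 y0 : ℝ) : ∃ φ g : ℝ → ℝ, ContDiff ℝ ∞ φ ∧ ContDiff ℝ ∞ g ∧ φ x0 = y0 ∧
      (∀ x, HasDerivAt φ (k x) x) ∧ (∀ x, g (φ x) = x) ∧ (∀ y, φ (g y) = y) ∧
      (∀ y, HasDerivAt g (k (g y))⁻¹ y) ∧ StrictMono φ ∧ StrictMono g ∧
      Filter.Tendsto g Filter.atTop Filter.atTop := by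
  set φ : ℝ → ℝ := fun x => y0 + ∫ t in x0..x, k t with hφ
  have hd : ∀ x, HasDerivAt φ (k x) x := fun x =>
    (intervalIntegral.integral_hasDerivAt_right (hk.continuous.intervalIntegrable _ _)
      (hk.continuous.stronglyMeasurableAtFilter _ _) hk.continuous.continuousAt).const_add y0
  have hder : deriv φ = k := funext fun x => (hd x).deriv
  have hsm : ContDiff ℝ ∞ φ := by
    rw [contDiff_infty_iff_deriv, hder]
    exact ⟨fun x => (hd x).differentiableAt, hk⟩
  have hmono : StrictMono φ := strictMono_of_deriv_pos fun x => by
    rw [hder]; exact he.trans_le (hke x)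
  have hm2 : Monotone (fun x => φ x - e * x) := by
    have h2 : ∀ x, HasDerivAt (fun x => φ x - e * x) (k x - e) x := fun x => by
      have := (hd x).fun_sub ((hasDerivAt_id x).const_mul e)
      rw [mul_one] at this
      exact this
    refine monotone_of_deriv_nonneg (fun x => (h2 x).differentiableAt) fun x => ?_
    rw [(h2 x).deriv]; linarith [hke x]
  have htop : Filter.Tendsto φ Filter.atTop Filter.atTop := by
    refine Filter.tendsto_atTop_mono' (f₁ := fun x => e * x + φ 0) _ ?_
      (Filter.tendsto_atTop_add_const_right _ _ (Filter.tendsto_id.const_mul_atTop he))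
    filter_upwards [Filter.eventually_ge_atTop 0] with x hx
    have := hm2 hx
    simp at this; linarith
  have hbot : Filter.Tendsto φ Filter.atBot Filter.atBot := by
    refine Filter.tendsto_atBot_mono' (f₁ := fun x => e * x + φ 0) _ ?_
      (Filter.tendsto_atBot_add_const_right _ _ (Filter.tendsto_id.const_mul_atBot he))
    filter_upwards [Filter.eventually_le_atBot 0] with x hx
    have := hm2 hx
    simp at this; linarith
  have hsurj : Function.Surjective φ := hsm.continuous.surjective htop hbot
  let o : ℝ ≃o ℝ := StrictMono.orderIsoOfSurjective φ hmono hsurj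
  have hg1 : ∀ x, o.symm (φ x) = x := fun x => o.symm_apply_apply x
  have hg2 : ∀ y, φ (o.symm y) = y := fun y => o.apply_symm_apply y
  have hdg : ∀ y, HasDerivAt o.symm (k (o.symm y))⁻¹ y := fun y =>
    HasDerivAt.of_local_left_inverse o.symm.continuous.continuousAt (hd _)
      (he.trans_le (hke _)).ne' (Filter.Eventually.of_forall hg2)
  refine ⟨φ, o.symm, hsm, ?_, by simp [hφ], hd, hg1, hg2, hdg, hmono, o.symm.strictMono,
    o.symm.tendsto_atTop⟩
  exact o.toHomeomorph.contDiff_symm_deriv (f' := k) (fun x => (he.trans_le (hke x)).ne') hd hsm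

theorem aux_glue (u v : ℝ → ℝ) (p q : ℝ) (hpq : p < q) (hu : ContDiff ℝ ∞ u)
    (hv : ContDiffOn ℝ ∞ v (Set.Ioi p)) (h : ∀ x ∈ Set.Ioo p q, u x = v x) :
    ContDiff ℝ ∞ (fun x => if x < q then u x else v x) := by
  rw [contDiff_iff_contDiffAt]
  intro x
  rcases lt_or_ge x q with hx | hx
  · refine hu.contDiffAt.congr_of_eventuallyEq ?_
    filter_upwards [Iio_mem_nhds hx] with y hy
    exact if_pos hy
  · have hp : p < x := hpq.trans_le hx
    refine (hv.contDiffAt (Ioi_mem_nhds hp)).congr_of_eventuallyEq ?_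
    filter_upwards [Ioi_mem_nhds hp] with y hy
    by_cases h1 : y < q
    · simp only [h1, if_true]; exact h y ⟨hy, h1⟩
    · simp only [h1, if_false]

/-- global extension of the profile near `b0` -/
theorem aux_ext (a b b0 : ℝ) (f : ℝ → ℝ) (hb0 : b0 ∈ Set.Ioo a b)
    (hf : ContDiffOn ℝ ∞ f (Set.Ioo a b)) (hp : 0 < deriv f b0) :
    ∃ ε > 0, ∃ k : ℝ → ℝ, ∃ lo > 0, ∃ hi, a < b0 - ε ∧ b0 + ε < b ∧ ContDiff ℝ ∞ k ∧
      (∀ x, lo ≤ k x) ∧ (∀ x, k x ≤ hi) ∧ ∀ x ∈ Set.Ioo (b0 - ε) (b0 + ε), k x = deriv f x := by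
  have hu : ContDiffOn ℝ ∞ (deriv f) (Set.Ioo a b) := hf.deriv_of_isOpen isOpen_Ioo (by simp)
  have hcont : ContinuousAt (deriv f) b0 := hu.continuousOn.continuousAt (isOpen_Ioo.mem_nhds hb0)
  have h1 : ∀ᶠ x in nhds b0, x ∈ Set.Ioo a b ∧ deriv f b0 / 2 < deriv f x ∧
      deriv f x < 2 * deriv f b0 :=
    (Filter.eventually_of_mem (isOpen_Ioo.mem_nhds hb0) fun _ hx => hx).and
      ((hcont.eventually (lt_mem_nhds (by linarith))).and
        (hcont.eventually (gt_mem_nhds (by linarith))))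
  obtain ⟨ρ, hρ, hball⟩ := Metric.eventually_nhds_iff_ball.1 h1
  have hbs : ∀ x, |x - b0| < ρ → x ∈ Set.Ioo a b ∧ deriv f b0 / 2 < deriv f x ∧
      deriv f x < 2 * deriv f b0 := fun x hx => hball x (by simpa [Real.dist_eq] using hx)
  let ψ : ContDiffBump b0 := ⟨ρ / 3, ρ / 2, by linarith, by linarith⟩
  have hsup : ∀ x, ρ / 2 ≤ |x - b0| → ψ x = 0 := fun x hx =>
    ψ.zero_of_le_dist (by simpa [Real.dist_eq] using hx)
  refine ⟨ρ / 3, by linarith, fun x => ψ x * deriv f x + (1 - ψ x), min (deriv f b0 / 2) 1,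
    by positivity, max (2 * deriv f b0) 1, ?_, ?_, ?_, ?_, ?_, ?_⟩
  · exact (hbs (b0 - ρ / 3) (by rw [abs_lt]; constructor <;> linarith)).1.1
  · exact (hbs (b0 + ρ / 3) (by rw [abs_lt]; constructor <;> linarith)).1.2
  · rw [contDiff_iff_contDiffAt]
    intro x
    have hψ : ContDiff ℝ ∞ ψ := ψ.contDiff
    rcases lt_or_ge |x - b0| ρ with hx | hx
    · have := (hu.contDiffAt (isOpen_Ioo.mem_nhds (hbs x hx).1))
      exact (hψ.contDiffAt.mul this).add (contDiffAt_const.sub hψ.contDiffAt)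
    · refine (contDiffAt_const (c := (1 : ℝ))).congr_of_eventuallyEq ?_
      have : ∀ᶠ y in nhds x, ρ / 2 < |y - b0| :=
        (continuous_abs.comp (continuous_id.sub continuous_const)).continuousAt.eventually
          (lt_mem_nhds (by simp; linarith))
      filter_upwards [this] with y hy
      simp [hsup y hy.le]
  · intro x
    have h0 := ψ.nonneg (x := x); have h1 := ψ.le_one (x := x)
    rcases lt_or_ge |x - b0| ρ with hx | hx
    · have := (hbs x hx).2.1
      have e1 := min_le_left (deriv f b0 / 2) 1
      have e2 := min_le_right (deriv f b0 / 2) 1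
      nlinarith
    · simp [hsup x (by linarith)]
  · intro x
    have h0 := ψ.nonneg (x := x); have h1 := ψ.le_one (x := x)
    rcases lt_or_ge |x - b0| ρ with hx | hx
    · have := (hbs x hx).2.2
      have e1 := le_max_left (2 * deriv f b0) 1
      have e2 := le_max_right (2 * deriv f b0) 1
      nlinarith
    · simp [hsup x (by linarith)]
  · intro x hx
    have : ψ x = 1 := ψ.one_of_mem_closedBall (by
      rw [Metric.mem_closedBall, Real.dist_eq, abs_le]
      constructor
      · have := hx.1; change -(ρ / 3) ≤ _; linarith
      · have := hx.2; change _ ≤ ρ / 3; linarith)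
    simp [this]

theorem aux_mu (Q r0 r : ℝ) (h0 : |Q| < r0) (h : r0 ≤ r) :
    (r0 ^ 2 + Q ^ 2) / (2 * r0) ≤ (r ^ 2 + Q ^ 2) / (2 * r) := by
  have hQ := abs_nonneg Q
  have hr0 : 0 < r0 := by linarith
  have hr : 0 < r := by linarith
  rw [div_le_div_iff₀ (by positivity) (by positivity)]
  have hq : Q ^ 2 ≤ r0 * r := by
    rw [← sq_abs]; nlinarith
  nlinarith [mul_nonneg (sub_nonneg.2 h) (sub_nonneg.2 hq)]

theorem aux_mass (Q r0 me δ : ℝ) (m0 : ℝ → ℝ) (hm0 : ContDiffOn ℝ ∞ m0 (Set.Ioi 0)) (hδ : 0 < δ)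
    (hd : ∀ r ∈ Set.Icc r0 (r0 + δ), 0 ≤ deriv m0 r) (hr0 : |Q| < r0) (hpos : 0 < m0 r0)
    (hlt : m0 r0 < (r0 ^ 2 + Q ^ 2) / (2 * r0)) (hme : m0 r0 < me) :
    ∃ m : ℝ → ℝ, ∃ R : ℝ, ContDiffOn ℝ ∞ m (Set.Ioi 0) ∧ (∀ r ∈ Set.Ioc 0 r0, m r = m0 r) ∧
      (∀ r, R ≤ r → m r = me) ∧ ∀ r, r0 ≤ r → 0 ≤ deriv m r ∧ 0 ≤ m r ∧
        m r < (r ^ 2 + Q ^ 2) / (2 * r) := by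
  have hQ := abs_nonneg Q
  have hr0' : 0 < r0 := by linarith
  obtain ⟨m1, hm1, hm1'⟩ := exists_between (lt_min hlt hme)
  rw [lt_min_iff] at hm1'
  obtain ⟨hm1a, hm1b⟩ := hm1'
  have hc : ContinuousAt m0 r0 := hm0.continuousOn.continuousAt (Ioi_mem_nhds hr0')
  obtain ⟨ρ, hρ, hball⟩ := Metric.eventually_nhds_iff_ball.1
    ((hc.eventually (lt_mem_nhds hpos)).and (hc.eventually (gt_mem_nhds hm1)))
  have hbs : ∀ x, |x - r0| < ρ → 0 < m0 x ∧ m0 x < m1 :=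
    fun x hx => hball x (by simpa [Real.dist_eq] using hx)
  set η := min δ (ρ / 2) with hη
  have hηp : 0 < η := lt_min hδ (by linarith)
  have hηδ : η ≤ δ := min_le_left _ _
  have hηρ : η ≤ ρ / 2 := min_le_right _ _
  set R0 := 2 * me + r0 + η with hR0
  set T := Real.smoothTransition with hT
  have hTs : ContDiff ℝ ∞ T := Real.smoothTransition.contDiff
  have hTm : Monotone T := Real.smoothTransition.monotone
  have hTd : ∀ x, 0 ≤ deriv T x := fun x => hTm.deriv_nonneg
  have hT0 : ∀ x, x ≤ 0 → T x = 0 := fun x hx => Real.smoothTransition.zero_of_nonpos hx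
  have hT1 : ∀ x, 1 ≤ x → T x = 1 := fun x hx => Real.smoothTransition.one_of_one_le hx
  have hTn : ∀ x, 0 ≤ T x := Real.smoothTransition.nonneg
  have hTl : ∀ x, T x ≤ 1 := Real.smoothTransition.le_one
  have hTdz : ∀ x, 1 < x → deriv T x = 0 := fun x hx => by
    have : T =ᶠ[nhds x] fun _ => 1 := by
      filter_upwards [Ioi_mem_nhds hx] with y hy using hT1 y (le_of_lt hy)
    rw [this.deriv_eq]; simp
  have hTD : ∀ x, HasDerivAt T (deriv T x) x := fun x =>
    ((hTs.differentiable (by simp)) x).hasDerivAt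
  let m : ℝ → ℝ := fun r => (1 - T ((r - r0) / η)) * m0 r + T ((r - r0) / η) * m1
    + (me - m1) * T (r - R0)
  have hDm : ∀ r, 0 < r → HasDerivAt m
      (-(deriv T ((r - r0) / η) * (1 / η)) * m0 r + (1 - T ((r - r0) / η)) * deriv m0 r
        + deriv T ((r - r0) / η) * (1 / η) * m1 + (me - m1) * deriv T (r - R0)) r := by
    intro r hr
    have h1 : HasDerivAt (fun r => T ((r - r0) / η)) (deriv T ((r - r0) / η) * (1 / η)) r :=
      HasDerivAt.comp (h₂ := T) r (hTD ((r - r0) / η)) (((hasDerivAt_id r).sub_const r0).div_const η)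
    have h2 : HasDerivAt (fun r => T (r - R0)) (deriv T (r - R0)) r := by
      have := (hTD (r - R0)).comp r ((hasDerivAt_id r).sub_const R0)
      rw [mul_one] at this; exact this
    have h3 : HasDerivAt m0 (deriv m0 r) r :=
      ((hm0.contDiffAt (Ioi_mem_nhds hr)).differentiableAt (by simp)).hasDerivAt
    exact (((h1.const_sub 1).mul h3).add (h1.mul_const m1)).add (h2.const_mul (me - m1))
  have h1s : ContDiff ℝ ∞ (fun r => T ((r - r0) / η)) := hTs.comp (by fun_prop)
  have h2s : ContDiff ℝ ∞ (fun r => T (r - R0)) := hTs.comp (by fun_prop)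
  have hm00 : 0 < m1 := by linarith
  refine ⟨m, R0 + 1, ?_, ?_, ?_, ?_⟩
  · exact (((contDiffOn_const.sub h1s.contDiffOn).mul hm0).add
      (h1s.contDiffOn.mul contDiffOn_const)).add (contDiffOn_const.mul h2s.contDiffOn)
  · intro r hr
    have e1 : T ((r - r0) / η) = 0 :=
      hT0 _ (div_nonpos_of_nonpos_of_nonneg (by linarith [hr.2]) hηp.le)
    have e2 : T (r - R0) = 0 := hT0 _ (by linarith [hr.2])
    simp only [m, e1, e2]; ring
  · intro r hr
    have e1 : T ((r - r0) / η) = 1 := hT1 _ (by rw [le_div_iff₀ hηp]; linarith)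
    have e2 : T (r - R0) = 1 := hT1 _ (by linarith)
    simp only [m, e1, e2]; ring
  · intro r hr
    have hrp : 0 < r := by linarith
    have hmu := aux_mu Q r0 r hr0 hr
    rw [(hDm r hrp).deriv]
    have d1 := hTd ((r - r0) / η)
    have d2 := hTd (r - R0)
    have n1 := hTn ((r - r0) / η)
    have l1 := hTl ((r - r0) / η)
    have n2 := hTn (r - R0)
    have l2 := hTl (r - R0)
    have hηi : 0 < 1 / η := by positivity
    rcases le_or_gt r (r0 + η) with hr1 | hr1
    · have e2 : T (r - R0) = 0 := hT0 _ (by linarith)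
      obtain ⟨b1, b2⟩ := hbs r (by rw [abs_lt]; constructor <;> linarith)
      have b3 := hd r ⟨hr, by linarith⟩
      refine ⟨?_, ?_, ?_⟩
      · have t1 := mul_nonneg (mul_nonneg d1 hηi.le) (sub_nonneg.2 b2.le)
        have t2 := mul_nonneg (sub_nonneg.2 l1) b3
        have t3 := mul_nonneg (sub_nonneg.2 hm1b.le) d2
        linarith
      · simp only [m, e2]
        have t2 := mul_nonneg (sub_nonneg.2 l1) b1.le
        have t3 := mul_nonneg n1 hm00.le
        linarith
      · simp only [m, e2]
        have t2 := mul_nonneg (sub_nonneg.2 l1) (sub_nonneg.2 b2.le)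
        linarith
    · have hx : 1 < (r - r0) / η := by rw [lt_div_iff₀ hηp]; linarith
      have e1 : T ((r - r0) / η) = 1 := hT1 _ hx.le
      have t3 := mul_nonneg (sub_nonneg.2 hm1b.le) d2
      have t4 := mul_nonneg (sub_nonneg.2 hm1b.le) n2
      refine ⟨?_, ?_, ?_⟩
      · rw [hTdz _ hx, e1]; linarith
      · simp only [m, e1]; linarith
      · simp only [m, e1]
        rcases le_or_gt r R0 with h5 | h5
        · rw [hT0 (r - R0) (by linarith)]; linarith
        · have t5 := mul_nonneg (sub_nonneg.2 hm1b.le) (sub_nonneg.2 l2)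
          have : me < (r ^ 2 + Q ^ 2) / (2 * r) := by
            rw [lt_div_iff₀ (by positivity)]
            nlinarith [sq_nonneg Q]
          linarith

theorem aux_core (b0 ε lo hi Q me : ℝ) (k φ g : ℝ → ℝ) (hε : 0 < ε) (hlo : 0 < lo)
    (hk : ContDiff ℝ ∞ k) (hklo : ∀ x, lo ≤ k x) (hkhi : ∀ x, k x ≤ hi)
    (hg : ContDiff ℝ ∞ g)
    (hgφ : ∀ x, g (φ x) = x) (hφg : ∀ y, φ (g y) = y)
    (hdg : ∀ y, HasDerivAt g (k (g y))⁻¹ y) (hφm : StrictMono φ) (hgm : StrictMono g)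
    (hDEC : ∀ s ∈ Set.Ioo (b0 - ε) (b0 + ε),
      deriv k s < 1 / (2 * φ s) * (1 - k s ^ 2 - Q ^ 2 / φ s ^ 2))
    (hr0 : |Q| < φ b0) (hmpos : 0 < φ b0 / 2 * (1 + Q ^ 2 / φ b0 ^ 2 - k b0 ^ 2))
    (hme : φ b0 / 2 * (1 + Q ^ 2 / φ b0 ^ 2 - k b0 ^ 2) < me) :
    ∃ G : ℝ → ℝ, ∃ L : ℝ, ContDiff ℝ ∞ G ∧ (∀ s ≤ b0, G s = φ s) ∧ (∀ s, 0 < deriv G s) ∧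
      StrictMono G ∧ Filter.Tendsto G Filter.atTop Filter.atTop ∧
      (∀ s, b0 ≤ s → deriv (deriv G) s ≤
        1 / (2 * G s) * (1 - deriv G s ^ 2 - Q ^ 2 / G s ^ 2)) ∧
      ∀ s, L ≤ s → deriv G s ^ 2 = 1 - 2 * me / G s + Q ^ 2 / G s ^ 2 := by
  have hkp : ∀ x, 0 < k x := fun x => hlo.trans_le (hklo x)
  set r0 := φ b0 with hr0def
  have hgr0 : g r0 = b0 := hgφ b0
  have hr0p : 0 < r0 := (abs_nonneg Q).trans_lt hr0
  let h0 : ℝ → ℝ := fun r => k (g r)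
  have hh0 : ContDiff ℝ ∞ h0 := hk.comp hg
  have hh0p : ∀ r, 0 < h0 r := fun r => hkp _
  have hkD : ∀ x, HasDerivAt k (deriv k x) x := fun x =>
    ((hk.differentiable (by simp)) x).hasDerivAt
  have hh0D : ∀ r, HasDerivAt h0 (deriv k (g r) * (k (g r))⁻¹) r := fun r =>
    HasDerivAt.comp (h₂ := k) r (hkD (g r)) (hdg r)
  let m0 : ℝ → ℝ := fun r => r / 2 * (1 + Q ^ 2 / r ^ 2 - h0 r ^ 2)
  have hm0s : ContDiffOn ℝ ∞ m0 (Set.Ioi 0) := by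
    have hd : ContDiffOn ℝ ∞ (fun r : ℝ => Q ^ 2 / r ^ 2) (Set.Ioi 0) :=
      contDiffOn_const.div (contDiff_id.pow 2).contDiffOn
        fun r hr => pow_ne_zero 2 (ne_of_gt hr)
    exact (contDiff_id.div_const 2).contDiffOn.mul
      ((contDiffOn_const.add hd).sub (hh0.pow 2).contDiffOn)
  have hm0D : ∀ r, 0 < r → HasDerivAt m0
      (r * (1 / (2 * r) * (1 - k (g r) ^ 2 - Q ^ 2 / r ^ 2) - deriv k (g r))) r := by
    intro r hr
    have h1 : HasDerivAt (fun r : ℝ => Q ^ 2 / r ^ 2) (-(2 * Q ^ 2) / r ^ 3) r := by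
      have := (hasDerivAt_const r (Q ^ 2)).fun_div ((hasDerivAt_id r).fun_pow 2)
        (pow_ne_zero 2 hr.ne')
      refine this.congr_deriv ?_
      simp
      field_simp
    have h2 := ((hasDerivAt_id r).div_const 2).mul
      (((h1.const_add 1)).sub ((hh0D r).fun_pow 2))
    refine h2.congr_deriv ?_
    have := (hkp (g r)).ne'
    simp [h0]
    field_simp
    ring
  obtain ⟨m, R, hms, hmeq, hmR, hmge⟩ := aux_mass Q r0 me (φ (b0 + ε / 2) - r0) m0 hm0s
    (by have := hφm (show b0 < b0 + ε / 2 by linarith); linarith)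
    (by
      intro r hr
      have hrp : 0 < r := hr0p.trans_le hr.1
      rw [(hm0D r hrp).deriv]
      have g1 : b0 ≤ g r := by rw [← hgr0]; exact hgm.monotone hr.1
      have g2 : g r ≤ b0 + ε / 2 := by
        rw [← hgφ (b0 + ε / 2)]; exact hgm.monotone (by linarith [hr.2])
      have := hDEC (g r) ⟨by linarith, by linarith⟩
      rw [hφg] at this
      exact mul_nonneg hrp.le (by linarith))
    hr0 (by simpa only [m0, h0, hgr0] using hmpos)
    (by
      simp only [m0, h0, hgr0]
      have : 0 < r0 * k b0 ^ 2 := mul_pos hr0p (pow_pos (hkp _) 2)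
      have e : (r0 ^ 2 + Q ^ 2) / (2 * r0) = r0 / 2 * (1 + Q ^ 2 / r0 ^ 2) := by
        field_simp
      rw [e]; nlinarith)
    (by simpa only [m0, h0, hgr0] using hme)
  let P : ℝ → ℝ := fun r => 1 - 2 * m r / r + Q ^ 2 / r ^ 2
  have hPs : ContDiffOn ℝ ∞ P (Set.Ioi 0) := by
    have hd : ContDiffOn ℝ ∞ (fun r : ℝ => Q ^ 2 / r ^ 2) (Set.Ioi 0) :=
      contDiffOn_const.div (contDiff_id.pow 2).contDiffOn
        fun r hr => pow_ne_zero 2 (ne_of_gt hr)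
    exact (contDiffOn_const.sub ((contDiffOn_const.mul hms).div contDiffOn_id
      fun r hr => ne_of_gt hr)).add hd
  have hPl : ∀ r ∈ Set.Ioc 0 r0, P r = h0 r ^ 2 := by
    intro r hr
    have := hr.1.ne'
    simp only [P, hmeq r hr, m0]
    field_simp
    ring
  have hPp : ∀ r, 0 < r → 0 < P r := by
    intro r hr
    rcases le_or_gt r r0 with h | h
    · rw [hPl r ⟨hr, h⟩]; exact pow_pos (hh0p r) 2
    · have := (hmge r h.le).2.2
      rw [lt_div_iff₀ (by positivity)] at this
      have e : P r = (r ^ 2 + Q ^ 2 - m r * (2 * r)) / r ^ 2 := by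
        simp only [P]; field_simp; ring
      rw [e]; exact div_pos (by linarith) (by positivity)
  have hP2 : ∀ r, r0 ≤ r → P r ≤ 4 := by
    intro r hr
    have hrp : 0 < r := by linarith
    have h1 : 0 ≤ 2 * m r / r := div_nonneg (by linarith [(hmge r hr).2.1]) hrp.le
    have h2 : Q ^ 2 / r ^ 2 ≤ 1 := by
      rw [div_le_one (by positivity), ← sq_abs Q]
      exact pow_le_pow_left₀ (abs_nonneg Q) (by linarith) 2
    simp only [P]; linarith
  let h : ℝ → ℝ := fun r => if r < r0 then h0 r else √(P r)
  have hhs : ContDiff ℝ ∞ h := by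
    refine aux_glue h0 (fun r => √(P r)) 0 r0 hr0p hh0
      (hPs.sqrt fun r hr => (hPp r hr).ne') ?_
    intro r hr
    simp only [hPl r ⟨hr.1, hr.2.le⟩]
    rw [Real.sqrt_sq (hh0p r).le]
  have hhl : ∀ r, r ≤ r0 → h r = h0 r := by
    intro r hr
    rcases hr.lt_or_eq with h1 | h1
    · exact if_pos h1
    · simp only [h, h1, lt_irrefl, if_false]
      rw [hPl r0 ⟨hr0p, le_rfl⟩, Real.sqrt_sq (hh0p r0).le]
  have hhP : ∀ r, 0 < r → h r = √(P r) := by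
    intro r hr
    by_cases h1 : r < r0
    · rw [hhl r h1.le, hPl r ⟨hr, h1.le⟩, Real.sqrt_sq (hh0p r).le]
    · exact if_neg h1
  have hhp : ∀ r, 0 < h r := by
    intro r
    by_cases h1 : r < r0
    · rw [hhl r h1.le]; exact hh0p r
    · rw [hhP r (by linarith)]; exact Real.sqrt_pos.2 (hPp r (by linarith))
  have hhb : ∀ r, h r ≤ max hi 2 := by
    intro r
    by_cases h1 : r < r0
    · rw [hhl r h1.le]; exact (hkhi _).trans (le_max_left _ _)
    · rw [hhP r (by linarith)]
      refine le_trans ?_ (le_max_right _ _)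
      rw [Real.sqrt_le_left (by norm_num)]
      linarith [hP2 r (by linarith)]
  have hmx : 0 < max hi 2 := lt_max_of_lt_right (by norm_num)
  obtain ⟨S, G, hSs, hGs, hS0, hSD, hGS, hSG, hGD, hSm, hGm, hGt⟩ :=
    aux_diffeo (fun r => (h r)⁻¹) (hhs.inv fun r => (hhp r).ne') (max hi 2)⁻¹
      (inv_pos.2 hmx) (fun r => inv_anti₀ (hhp r) (hhb r)) r0 b0
  simp only [inv_inv] at hGD
  have hSg : ∀ r, r ≤ r0 → S r = g r := by
    intro r hr
    have i1 := intervalIntegral.integral_eq_sub_of_hasDerivAt (a := r) (b := r0) (f := S)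
      (fun x _ => hSD x)
      ((hhs.inv fun r => (hhp r).ne').continuous.intervalIntegrable _ _)
    have i2 := intervalIntegral.integral_eq_sub_of_hasDerivAt (a := r) (b := r0) (f := g)
      (fun x _ => hdg x)
      ((hh0.inv fun r => (hh0p r).ne').continuous.intervalIntegrable _ _)
    have i3 : ∫ x in r..r0, (h x)⁻¹ = ∫ x in r..r0, (k (g x))⁻¹ := by
      refine intervalIntegral.integral_congr fun x hx => ?_
      rw [Set.uIcc_of_le hr] at hx
      simp only [hhl x hx.2, h0]
    rw [i1, i2, hS0, hgr0] at i3
    linarith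
  have hGb0 : G b0 = r0 := by rw [← hS0, hGS]
  have hdG : deriv G = fun s => h (G s) := funext fun s => (hGD s).deriv
  have hGge : ∀ s, b0 ≤ s → r0 ≤ G s := fun s hs => by
    rw [← hGb0]; exact hGm.monotone hs
  have hsq : ∀ r, 0 < r → h r ^ 2 = P r := fun r hr => by
    rw [hhP r hr, Real.sq_sqrt (hPp r hr).le]
  refine ⟨G, max b0 (S R), hGs, ?_, fun s => ?_, hGm, hGt, ?_, ?_⟩
  · intro s hs
    have : φ s ≤ r0 := hφm.monotone hs
    have := hSg _ this
    rw [hgφ] at this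
    rw [← this, hGS, this]
  · rw [hdG]; exact hhp _
  · intro s hs
    have hr := hGge s hs
    have hrp : 0 < G s := by linarith
    have hhD : HasDerivAt h (deriv h (G s)) (G s) :=
      ((hhs.differentiable (by simp)) _).hasDerivAt
    have hGG : deriv (deriv G) s = deriv h (G s) * h (G s) := by
      rw [hdG]
      exact (HasDerivAt.comp (h₂ := h) s hhD (hGD s)).deriv
    have hPh : HasDerivAt P (2 * h (G s) * deriv h (G s)) (G s) := by
      have := hhD.fun_pow 2
      have h3 : P =ᶠ[nhds (G s)] fun r => h r ^ 2 := by
        filter_upwards [Ioi_mem_nhds hrp] with r hr using (hsq r hr).symm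
      refine (this.congr_of_eventuallyEq h3).congr_deriv ?_
      simp
    have hmD : HasDerivAt m (deriv m (G s)) (G s) :=
      ((hms.contDiffAt (Ioi_mem_nhds hrp)).differentiableAt (by simp)).hasDerivAt
    have hP2 : HasDerivAt P (-2 * deriv m (G s) / G s + 2 * m (G s) / G s ^ 2
        - 2 * Q ^ 2 / G s ^ 3) (G s) := by
      have h1 := (hasDerivAt_const (G s) (Q ^ 2)).fun_div ((hasDerivAt_id (G s)).fun_pow 2)
        (pow_ne_zero 2 hrp.ne')
      have h2 := (hmD.const_mul 2).fun_div (hasDerivAt_id (G s)) hrp.ne'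
      refine ((h2.const_sub 1).add h1).congr_deriv ?_
      simp
      field_simp
      ring
    have heq := hPh.unique hP2
    have hmn := (hmge (G s) hr).1
    rw [hGG, hdG]
    simp only [hsq _ hrp, P]
    have e : 1 / (2 * G s) * (1 - (1 - 2 * m (G s) / G s + Q ^ 2 / G s ^ 2) - Q ^ 2 / G s ^ 2)
        = m (G s) / G s ^ 2 - Q ^ 2 / G s ^ 3 := by
      field_simp
      ring
    rw [e]
    have : 0 ≤ deriv m (G s) / G s := div_nonneg hmn hrp.le
    have e2 : -2 * deriv m (G s) / G s + 2 * m (G s) / G s ^ 2 - 2 * Q ^ 2 / G s ^ 3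
      = 2 * (-(deriv m (G s) / G s) + (m (G s) / G s ^ 2 - Q ^ 2 / G s ^ 3)) := by ring
    rw [e2] at heq
    linarith
  · intro s hs
    have hr := hGge s ((le_max_left _ _).trans hs)
    have hR : R ≤ G s := by
      rw [← hGS R]; exact hGm.monotone ((le_max_right _ _).trans hs)
    rw [hdG]
    simp only
    rw [hsq _ (by linarith)]
    simp only [P, hmR _ hR]

theorem aux_join (p q : ℝ → ℝ) (a b d : ℝ) (hab : a < b) (hp : HasDerivAt p d a)
    (hq : HasDerivWithinAt q d (Set.Icc a b) a) (hpq : p a = q a) :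
    HasDerivAt (fun s => if s < a then p s else q s) d a := by
  have h1 : HasDerivWithinAt (fun s => if s < a then p s else q s) d (Set.Iic a) a := by
    refine hp.hasDerivWithinAt.congr ?_ (by simp [hpq])
    intro s hs
    rcases (Set.mem_Iic.1 hs).lt_or_eq with h | h
    · simp [h]
    · simp [h, hpq]
  have h2 : HasDerivWithinAt (fun s => if s < a then p s else q s) d (Set.Ici a) a := by
    have h3 : HasDerivWithinAt q d (Set.Ici a) a :=
      hq.mono_of_mem_nhdsWithin (Icc_mem_nhdsGE hab)
    refine h3.congr ?_ (by simp)
    intro s hs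
    simp [not_lt.2 (Set.mem_Ici.1 hs)]
  have := h1.union h2
  rw [Set.Iic_union_Ici] at this
  exact hasDerivWithinAt_univ.1 this


/-- Proposition 4.6 in terms of radial profile functions: a rotationally symmetric
electrically charged collar `[a,b]` satisfying the strict charged DEC inequality, with
outer boundary of radius `f(b) > |Q|`, positive mean curvature (`f'(b) > 0`), and charged
Hawking mass `m* = (f(b)/2)(1 + Q²/f(b)² - f'(b)²) > |Q|`, can be glued to an exterior
sub-extremal Reissner–Nordström region of any mass `mₑ > m*`, preserving the charged DEC
inequality; if moreover `f' > 0` on `(a,b]`, the glued profile is strictly increasing on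
`(a,∞)`. -/
theorem stmt_8 (a b Q : ℝ) (hab : a < b) (f : ℝ → ℝ)
    (hf : ContDiffOn ℝ (⊤ : ℕ∞) f (Set.Icc a b))
    (hpos : ∀ s ∈ Set.Icc a b, 0 < f s)
    (hDEC : ∀ s ∈ Set.Icc a b,
      deriv (deriv f) s <
        (1 / (2 * f s)) * (1 - (deriv f s) ^ 2 - Q ^ 2 / (f s) ^ 2))
    (hfb : f b > |Q|)
    (hfb' : deriv f b > 0)
    (hm : (f b / 2) * (1 + Q ^ 2 / (f b) ^ 2 - (deriv f b) ^ 2) > |Q|) :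
    ∀ m_e : ℝ, m_e > (f b / 2) * (1 + Q ^ 2 / (f b) ^ 2 - (deriv f b) ^ 2) →
      ∃ L : ℝ, b ≤ L ∧ ∃ F : ℝ → ℝ,
        ContDiffOn ℝ (⊤ : ℕ∞) F (Set.Ici a) ∧
        (∀ s ∈ Set.Ici a, 0 < F s) ∧
        (∀ s ∈ Set.Icc a ((a + b) / 2), F s = f s) ∧
        (∀ s ∈ Set.Ici a,
          deriv (deriv F) s ≤
            (1 / (2 * F s)) * (1 - (deriv F s) ^ 2 - Q ^ 2 / (F s) ^ 2)) ∧
        (∀ s ∈ Set.Ici L,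
          0 < deriv F s ∧
          (deriv F s) ^ 2 = 1 - 2 * m_e / F s + Q ^ 2 / (F s) ^ 2) ∧
        Filter.Tendsto F Filter.atTop Filter.atTop ∧
        ((∀ s ∈ Set.Ioc a b, 0 < deriv f s) →
          ∀ s ∈ Set.Ioi a, 0 < deriv F s) := by
  intro me hme
  have hf' : ContDiffOn ℝ ∞ f (Set.Icc a b) := hf
  have hfo : ContDiffOn ℝ ∞ f (Set.Ioo a b) := hf'.mono Set.Ioo_subset_Icc_self
  have hU := uniqueDiffOn_Icc hab
  set u := derivWithin f (Set.Icc a b) with hu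
  set w := derivWithin u (Set.Icc a b) with hw
  have hus : ContDiffOn ℝ ∞ u (Set.Icc a b) := hf'.derivWithin hU (by simp)
  have hws : ContDiffOn ℝ ∞ w (Set.Icc a b) := hus.derivWithin hU (by simp)
  have huo : ∀ s ∈ Set.Ioo a b, u s = deriv f s := fun s hs =>
    derivWithin_of_mem_nhds (Icc_mem_nhds hs.1 hs.2)
  have hwo : ∀ s ∈ Set.Ioo a b, w s = deriv (deriv f) s := fun s hs => by
    rw [hw, derivWithin_of_mem_nhds (Icc_mem_nhds hs.1 hs.2)]
    refine Filter.EventuallyEq.deriv_eq ?_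
    filter_upwards [isOpen_Ioo.mem_nhds hs] with t ht using huo t ht
  have hub : u b = deriv f b :=
    (differentiableAt_of_deriv_ne_zero hfb'.ne').derivWithin
      (hU b (Set.right_mem_Icc.2 hab.le))
  have hfbp : 0 < f b := hpos b (Set.right_mem_Icc.2 hab.le)
  have hcf := hf'.continuousOn
  have hcu := hus.continuousOn
  have hcw := hws.continuousOn
  -- choice of the cut point
  obtain ⟨b0, hb0, hQ0, hu0, hM0, hM1⟩ : ∃ b0 ∈ Set.Ioo ((a + b) / 2) b, |Q| < f b0 ∧ 0 < u b0 ∧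
      0 < f b0 / 2 * (1 + Q ^ 2 / f b0 ^ 2 - u b0 ^ 2) ∧
      f b0 / 2 * (1 + Q ^ 2 / f b0 ^ 2 - u b0 ^ 2) < me := by
    have hb : b ∈ Set.Icc a b := Set.right_mem_Icc.2 hab.le
    have hsub : Set.Ioo ((a + b) / 2) b ⊆ Set.Icc a b := fun s hs =>
      ⟨by linarith [hs.1], hs.2.le⟩
    have c1 : ContinuousWithinAt f (Set.Ioo ((a + b) / 2) b) b := (hcf b hb).mono hsub
    have c2 : ContinuousWithinAt u (Set.Ioo ((a + b) / 2) b) b := (hcu b hb).mono hsub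
    have c3 : ContinuousWithinAt (fun s => f s / 2 * (1 + Q ^ 2 / f s ^ 2 - u s ^ 2))
        (Set.Ioo ((a + b) / 2) b) b :=
      (c1.div_const 2).mul (((continuousWithinAt_const).add
        (continuousWithinAt_const.div (c1.pow 2) (pow_ne_zero 2 hfbp.ne'))).sub (c2.pow 2))
    have hne : (nhdsWithin b (Set.Ioo ((a + b) / 2) b)).NeBot := by
      rw [nhdsWithin_Ioo_eq_nhdsLT (by linarith)]; infer_instance
    have hMb : |Q| < f b / 2 * (1 + Q ^ 2 / f b ^ 2 - u b ^ 2) := by rw [hub]; exact hm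
    have hMb2 : f b / 2 * (1 + Q ^ 2 / f b ^ 2 - u b ^ 2) < me := by rw [hub]; exact hme
    have ev := (((c1.eventually (lt_mem_nhds hfb)).and
      (c2.eventually (lt_mem_nhds (show 0 < u b by rw [hub]; exact hfb')))).and
      ((c3.eventually (lt_mem_nhds ((abs_nonneg Q).trans_lt hMb))).and
        (c3.eventually (gt_mem_nhds hMb2)))).and
      (eventually_mem_nhdsWithin (a := b) (s := Set.Ioo ((a + b) / 2) b))
    obtain ⟨s, ⟨⟨h1, h2⟩, h3, h4⟩, h5⟩ := ev.exists
    exact ⟨s, h5, h1, h2, h3, h4⟩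
  have hb0I : b0 ∈ Set.Ioo a b := ⟨by linarith [hb0.1], hb0.2⟩
  have hab0 : a < b0 := hb0I.1
  rw [huo b0 hb0I] at hu0 hM0 hM1
  obtain ⟨ε, hε, k, lo, hlo, hi, hεa, hεb, hk, hklo, hkhi, hkf⟩ := aux_ext a b b0 f hb0I hfo hu0
  obtain ⟨φ, g, hφs, hgs, hφ0, hφD, hgφ, hφg, hgD, hφm, hgm, -⟩ :=
    aux_diffeo k hk lo hlo hklo b0 (f b0)
  have hεsub : Set.Ioo (b0 - ε) (b0 + ε) ⊆ Set.Ioo a b := fun s hs =>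
    ⟨by linarith [hs.1], by linarith [hs.2]⟩
  have hb0ε : b0 ∈ Set.Ioo (b0 - ε) (b0 + ε) := ⟨by linarith, by linarith⟩
  have hφf : Set.EqOn φ f (Set.Ioo (b0 - ε) (b0 + ε)) := by
    refine isOpen_Ioo.eqOn_of_deriv_eq isPreconnected_Ioo
      (fun s _ => (hφD s).differentiableAt.differentiableWithinAt)
      ((hfo.differentiableOn (by simp)).mono hεsub) ?_ hb0ε hφ0
    intro s hs
    rw [(hφD s).deriv, hkf s hs]
  obtain ⟨G, L, hGs, hGφ, hGp, hGm, hGt, hGD, hGL⟩ := aux_core b0 ε lo hi Q me k φ g hε hlo hk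
    hklo hkhi hgs hgφ hφg hgD hφm hgm
    (by
      intro s hs
      have e : deriv k s = deriv (deriv f) s := by
        refine Filter.EventuallyEq.deriv_eq ?_
        filter_upwards [isOpen_Ioo.mem_nhds hs] with t ht using hkf t ht
      rw [e, hφf hs, hkf s hs]
      exact hDEC s (Set.Ioo_subset_Icc_self (hεsub hs)))
    (by rw [hφ0]; exact hQ0)
    (by rw [hφ0, hkf b0 hb0ε]; exact hM0)
    (by rw [hφ0, hkf b0 hb0ε]; exact hM1)
  let F : ℝ → ℝ := fun s => if s < a then f a + u a * (s - a) + w a / 2 * (s - a) ^ 2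
    else if s < b0 then f s else G s
  have hFf : ∀ s, a ≤ s → s < b0 → F s = f s := fun s h1 h2 => by
    simp only [F, not_lt.2 h1, h2, if_true, if_false]
  have hFG : ∀ s, b0 - ε < s → F s = G s := fun s h1 => by
    have h2 : ¬ s < a := by linarith
    by_cases h3 : s < b0
    · simp only [F, h2, h3, if_true, if_false]
      rw [hGφ s h3.le]
      exact (hφf ⟨h1, by linarith⟩).symm
    · simp only [F, h2, h3, if_false]
  have hFGe : ∀ s, b0 ≤ s → F =ᶠ[nhds s] G := fun s hs => by
    filter_upwards [Ioi_mem_nhds (show b0 - ε < s by linarith)] with t ht using hFG t ht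
  have hFfe : ∀ s ∈ Set.Ioo a b0, F =ᶠ[nhds s] f := fun s hs => by
    filter_upwards [isOpen_Ioo.mem_nhds hs] with t ht using hFf t ht.1.le ht.2
  have hGb0 : G b0 = f b0 := by rw [hGφ b0 le_rfl, hφ0]
  -- first and second derivative at `a`
  have haI : a ∈ Set.Icc a b := Set.left_mem_Icc.2 hab.le
  have hfa : HasDerivWithinAt f (u a) (Set.Icc a b) a :=
    ((hf'.differentiableOn (by simp)) a haI).hasDerivWithinAt
  have hua : HasDerivWithinAt u (w a) (Set.Icc a b) a :=
    ((hus.differentiableOn (by simp)) a haI).hasDerivWithinAt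
  have hpoly : ∀ s, HasDerivAt (fun s => f a + u a * (s - a) + w a / 2 * (s - a) ^ 2)
      (u a + w a * (s - a)) s := fun s => by
    have h1 := (hasDerivAt_id s).sub_const a
    refine (((h1.const_mul (u a)).const_add (f a)).add
      ((h1.fun_pow 2).const_mul (w a / 2))).congr_deriv ?_
    simp
    ring
  have hFa : HasDerivAt F (u a) a := by
    have h1 := aux_join _ f a b (u a) hab ((hpoly a).congr_deriv (by ring)) hfa (by simp)
    refine h1.congr_of_eventuallyEq ?_
    filter_upwards [Iio_mem_nhds hab0] with t ht
    have ht' : t < b0 := ht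
    by_cases h3 : t < a
    · simp only [F, h3, if_true]
    · simp only [F, h3, ht', if_true, if_false]
  have hdF : ∀ s, s < b0 → deriv F s = if s < a then u a + w a * (s - a) else u s := by
    intro s hs
    rcases lt_trichotomy s a with h | h | h
    · rw [if_pos h]
      have : F =ᶠ[nhds s] fun s => f a + u a * (s - a) + w a / 2 * (s - a) ^ 2 := by
        filter_upwards [Iio_mem_nhds h] with t ht using if_pos ht
      rw [this.deriv_eq]; exact (hpoly s).deriv
    · rw [h, if_neg (lt_irrefl a)]; exact hFa.deriv
    · rw [if_neg (not_lt.2 h.le), (hFfe s ⟨h, hs⟩).deriv_eq,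
        huo s ⟨h, by linarith [hb0.2]⟩]
  have hddFa : deriv (deriv F) a = w a := by
    have h0 : HasDerivAt (fun s => u a + w a * (s - a)) (w a) a :=
      ((((hasDerivAt_id a).sub_const a).const_mul (w a)).const_add (u a)).congr_deriv (by simp)
    have h1 := aux_join _ u a b (w a) hab h0 hua (by simp)
    refine (h1.congr_of_eventuallyEq ?_).deriv
    filter_upwards [Iio_mem_nhds hab0] with t ht using hdF t ht
  have hDECa : w a ≤ 1 / (2 * f a) * (1 - u a ^ 2 - Q ^ 2 / f a ^ 2) := by
    have hfap := hpos a haI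
    have c1 : ContinuousWithinAt f (Set.Ioo a b) a := (hcf a haI).mono Set.Ioo_subset_Icc_self
    have c2 : ContinuousWithinAt u (Set.Ioo a b) a := (hcu a haI).mono Set.Ioo_subset_Icc_self
    have c3 : ContinuousWithinAt w (Set.Ioo a b) a := (hcw a haI).mono Set.Ioo_subset_Icc_self
    have c4 : ContinuousWithinAt (fun s => 1 / (2 * f s) * (1 - u s ^ 2 - Q ^ 2 / f s ^ 2))
        (Set.Ioo a b) a :=
      (continuousWithinAt_const.div (continuousWithinAt_const.mul c1) (mul_pos two_pos hfap).ne').mul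
        ((continuousWithinAt_const.sub (c2.pow 2)).sub
          (continuousWithinAt_const.div (c1.pow 2) (pow_ne_zero 2 hfap.ne')))
    refine ContinuousWithinAt.closure_le (s := Set.Ioo a b)
      (by rw [closure_Ioo hab.ne]; exact haI) c3 c4 ?_
    intro s hs
    simp only [hwo s hs, huo s hs]
    exact (hDEC s (Set.Ioo_subset_Icc_self hs)).le
  refine ⟨max b L, le_max_left _ _, F, ?_, ?_, ?_, ?_, ?_, ?_, ?_⟩
  · intro s hs
    have hs' : a ≤ s := hs
    rcases lt_or_ge s b0 with h | h
    · have hsb : s < b := h.trans hb0.2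
      have h1 : ContDiffWithinAt ℝ ∞ f (Set.Ici a) s := by
        refine (hf' s ⟨hs', hsb.le⟩).mono_of_mem_nhdsWithin ?_
        rw [← Set.Ici_inter_Iic]
        exact Filter.inter_mem self_mem_nhdsWithin (mem_nhdsWithin_of_mem_nhds (Iic_mem_nhds hsb))
      refine h1.congr_of_eventuallyEq ?_ (hFf s hs' h)
      filter_upwards [self_mem_nhdsWithin, mem_nhdsWithin_of_mem_nhds (Iio_mem_nhds h)]
        with t ht1 ht2 using hFf t ht1 ht2
    · exact ((hGs.contDiffAt (x := s)).congr_of_eventuallyEq (hFGe s h)).contDiffWithinAt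
  · intro s hs
    have hs' : a ≤ s := hs
    rcases lt_or_ge s b0 with h | h
    · rw [hFf s hs' h]; exact hpos s ⟨hs', (h.trans hb0.2).le⟩
    · rw [hFG s (by linarith)]
      refine lt_of_lt_of_le ?_ (hGm.monotone h)
      rw [hGb0]; exact hpos b0 (Set.Ioo_subset_Icc_self hb0I)
  · intro s hs
    exact hFf s hs.1 (hs.2.trans_lt hb0.1)
  · intro s hs
    have hs' : a ≤ s := hs
    rcases lt_or_ge s b0 with h | h
    · rcases hs'.eq_or_lt with h1 | h1
      · rw [← h1, hddFa, hFa.deriv, hFf a le_rfl hab0]; exact hDECa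
      · have e := hFfe s ⟨h1, h⟩
        rw [e.deriv.deriv_eq, e.deriv_eq, e.eq_of_nhds]
        exact (hDEC s ⟨hs', (h.trans hb0.2).le⟩).le
    · have e := hFGe s h
      rw [e.deriv.deriv_eq, e.deriv_eq, e.eq_of_nhds]
      exact hGD s h
  · intro s hs
    have hs' : max b L ≤ s := hs
    have hsb : b ≤ s := (le_max_left _ _).trans hs'
    have e := hFGe s (hb0.2.le.trans hsb)
    rw [e.deriv_eq, e.eq_of_nhds]
    exact ⟨hGp s, hGL s ((le_max_right _ _).trans hs')⟩
  · refine hGt.congr' ?_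
    filter_upwards [Filter.eventually_ge_atTop b0] with s hs using ((hFGe s hs).eq_of_nhds).symm
  · intro hp s hs
    have hs' : a < s := hs
    rcases lt_or_ge s b0 with h | h
    · rw [(hFfe s ⟨hs', h⟩).deriv_eq]; exact hp s ⟨hs', (h.trans hb0.2).le⟩
    · rw [(hFGe s h).deriv_eq]; exact hGp s
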